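/- Let n be a positive integer, write n = 2^α · N with N odd, and set r = 2^{α+2}. For each integer j ≥ 3 let ψ_j denote the minimal polynomial over ℚ of 2·cos(2π/j). Then the n-th Chebyshev polynomial of the first kind satisfies, as polynomials over ℚ, T_n(X) = (1/2) · ∏_{d ∣ N} ψ_{r·d}(2X), where the product runs over all positive divisors d of N and ψ_{r·d}(2X) denotes the composition of ψ_{r·d} with the polynomial 2X. -/

import Mathlib

open Polynomial Real

namespace Polynomial.Chebyshev

theorem natDegree_C_natCast (n : ℕ) : (Chebyshev.C ℚ n).natDegree = n := by
  have h := congrArg natDegree (C_comp_two_mul_X ℚ n)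
  have h2 : (2 : ℚ[X]) = Polynomial.C 2 := rfl
  rw [natDegree_comp, h2, natDegree_C_mul two_ne_zero, natDegree_C_mul two_ne_zero, natDegree_T,
    natDegree_X] at h
  simpa using h

theorem monic_C_natCast {n : ℕ} (hn : 0 < n) : (Chebyshev.C ℚ n).Monic := by
  have h := congrArg leadingCoeff (C_comp_two_mul_X ℚ n)
  have h2 : (2 : ℚ[X]) = Polynomial.C 2 := rfl
  rw [leadingCoeff_comp (by rw [h2, natDegree_C_mul two_ne_zero, natDegree_X]; exact one_ne_zero),
    h2, leadingCoeff_mul, leadingCoeff_mul, leadingCoeff_T, leadingCoeff_C, leadingCoeff_X,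
    natDegree_C_natCast, mul_one, Int.natAbs_natCast, mul_pow_sub_one hn.ne'] at h
  exact mul_right_cancel₀ (pow_ne_zero n two_ne_zero) (h.trans (one_mul _).symm)

end Polynomial.Chebyshev

theorem isIntegral_two_mul_cos_two_pi_div (j : ℕ) :
    IsIntegral ℚ (2 * Real.cos (2 * Real.pi / j)) := by
  have h := isIntegral_two_mul_cos_rat_mul_pi (2 / j)
  have e : 2 * Real.pi / j = ((2 / j : ℚ) : ℝ) * Real.pi := by push_cast; ring
  rw [e]
  exact h.tower_top

/-- If `x + x⁻¹` is a root of the nonzero polynomial `p`, then `x` is a root of a polynomial of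
twice the degree, so that its own degree is at most `2 * p.natDegree`. -/
theorem natDegree_minpoly_le_of_aeval_add_inv {K L : Type*} [Field K] [Field L] [Algebra K L]
    {x : L} (hx : x ≠ 0) {p : K[X]} (hp : p ≠ 0) (h : aeval (x + x⁻¹) p = 0) :
    (minpoly K x).natDegree ≤ 2 * p.natDegree := by
  set m := p.natDegree with hm
  set q : K[X] := ∑ i ∈ Finset.range (m + 1), C (p.coeff i) * (X ^ (m - i) * (X ^ 2 + 1) ^ i)
    with hq
  have hq0 : q ≠ 0 := by
    intro h0
    have : q.eval 0 = p.leadingCoeff := by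
      rw [hq, eval_finsetSum, Finset.sum_eq_single m]
      · simp [hm]
      · intro i hi hne
        have : m - i ≠ 0 := by have := Finset.mem_range.mp hi; omega
        simp [this]
      · simp
    rw [h0, eval_zero] at this
    exact hp (leadingCoeff_eq_zero.mp this.symm)
  have hqx : aeval x q = 0 := by
    have : aeval x q = x ^ m * aeval (x + x⁻¹) p := by
      rw [aeval_eq_sum_range (p := p), hq, map_sum, Finset.mul_sum]
      refine Finset.sum_congr rfl fun i hi => ?_
      have e : x ^ 2 + 1 = x * (x + x⁻¹) := by field_simp
      have e' : x ^ m = x ^ (m - i) * x ^ i := by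
        rw [← pow_add, Nat.sub_add_cancel (Nat.lt_succ_iff.mp (Finset.mem_range.mp hi))]
      simp only [map_mul, map_pow, map_add, map_one, aeval_X, aeval_C, Algebra.smul_def]
      rw [e, e', mul_pow]
      ring
    rw [this, h, mul_zero]
  refine (natDegree_le_of_dvd (minpoly.dvd K x hqx) hq0).trans ?_
  refine natDegree_sum_le_of_forall_le _ _ fun i hi => ?_
  have hi' := Finset.mem_range.mp hi
  refine (natDegree_C_mul_le _ _).trans (natDegree_mul_le.trans ?_)
  have h1 : ((X ^ 2 + 1 : K[X]) ^ i).natDegree ≤ i * 2 :=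
    natDegree_pow_le_of_le i (by compute_degree)
  have h2 : (X ^ (m - i) : K[X]).natDegree ≤ m - i := natDegree_X_pow_le _
  omega

theorem totient_le_two_mul_natDegree_minpoly_two_mul_cos {j : ℕ} (hj : 0 < j) :
    j.totient ≤ 2 * (minpoly ℚ (2 * Real.cos (2 * Real.pi / j))).natDegree := by
  have hζ := Complex.isPrimitiveRoot_exp j hj.ne'
  rw [← natDegree_cyclotomic j ℚ, cyclotomic_eq_minpoly_rat hζ hj]
  refine natDegree_minpoly_le_of_aeval_add_inv (Complex.exp_ne_zero _)
    (minpoly.ne_zero (isIntegral_two_mul_cos_two_pi_div j)) ?_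
  have e : Complex.exp (2 * π * Complex.I / j) + (Complex.exp (2 * π * Complex.I / j))⁻¹ =
      algebraMap ℝ ℂ (2 * Real.cos (2 * Real.pi / j)) := by
    rw [← Complex.exp_neg, Complex.coe_algebraMap]
    push_cast
    rw [Complex.two_cos]
    congr 2 <;> ring
  rw [e, aeval_algebraMap_apply, minpoly.aeval, map_zero]

theorem aeval_C_two_mul_cos (m : ℕ) (θ : ℝ) :
    aeval (2 * Real.cos θ) (Chebyshev.C ℚ m) = 2 * Real.cos (m * θ) := by
  rw [Chebyshev.aeval_C, Chebyshev.C_two_mul_real_cos, Int.cast_natCast]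

theorem minpoly_two_mul_cos_dvd_C {m k : ℕ} (hm : 0 < m) (hk : Odd k) :
    minpoly ℚ (2 * Real.cos (2 * Real.pi / (4 * m : ℕ))) ∣ Chebyshev.C ℚ (m * k : ℕ) := by
  apply minpoly.dvd
  obtain ⟨l, rfl⟩ := hk
  rw [aeval_C_two_mul_cos, mul_eq_zero, Real.cos_eq_zero_iff]
  refine Or.inr ⟨l, ?_⟩
  have : (m : ℝ) ≠ 0 := by positivity
  push_cast
  field_simp
  ring

theorem dvd_of_minpoly_two_mul_cos_eq {m k : ℕ} (hm : 0 < m) (hk : 0 < k)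
    (h : minpoly ℚ (2 * Real.cos (2 * Real.pi / (4 * m : ℕ))) =
      minpoly ℚ (2 * Real.cos (2 * Real.pi / (4 * k : ℕ)))) : k ∣ m := by
  have h1 := minpoly_two_mul_cos_dvd_C hm odd_one
  rw [h, mul_one] at h1
  have h2 := aeval_eq_zero_of_dvd_aeval_eq_zero h1 (minpoly.aeval _ _)
  rw [aeval_C_two_mul_cos, mul_eq_zero, Real.cos_eq_zero_iff] at h2
  obtain ⟨l, hl⟩ := h2.resolve_left two_ne_zero
  have hk' : (k : ℝ) ≠ 0 := by positivity
  have hπ := Real.pi_ne_zero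
  push_cast at hl
  field_simp at hl
  have h3 : (m : ℝ) = k * (2 * l + 1) := by linarith
  exact Int.natCast_dvd_natCast.mp ⟨2 * l + 1, by exact_mod_cast h3⟩

/-- Factorization of the rescaled Chebyshev polynomial `2 * T_n (X / 2)` over `ℚ`. -/
theorem chebyshevC_factorization (α : ℕ) {N : ℕ} (hN : Odd N) :
    Chebyshev.C ℚ (2 ^ α * N : ℕ) =
      ∏ d ∈ N.divisors, minpoly ℚ (2 * Real.cos (2 * Real.pi / (4 * (2 ^ α * d) : ℕ))) := by
  have hpos : ∀ d ∈ N.divisors, 0 < 2 ^ α * d := fun d hd =>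
    Nat.mul_pos (by positivity) (Nat.pos_of_mem_divisors hd)
  have hmonic : ∀ d ∈ N.divisors,
      (minpoly ℚ (2 * Real.cos (2 * Real.pi / (4 * (2 ^ α * d) : ℕ)))).Monic := fun d _ =>
    minpoly.monic (isIntegral_two_mul_cos_two_pi_div _)
  refine eq_of_monic_of_dvd_of_natDegree_le (monic_prod_of_monic _ _ hmonic)
    (Chebyshev.monic_C_natCast (Nat.mul_pos (by positivity) hN.pos)) ?_ ?_
  · refine Finset.prod_dvd_of_isRelPrime (fun d hd e he hde => ?_) fun d hd => ?_
    · refine ((minpoly.irreducible (isIntegral_two_mul_cos_two_pi_div _)).isRelPrime_iff_not_dvd).2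
        fun hdvd => hde ?_
      have heq := eq_of_monic_of_associated (hmonic d hd) (hmonic e he)
        ((minpoly.irreducible (isIntegral_two_mul_cos_two_pi_div _)).associated_of_dvd
          (minpoly.irreducible (isIntegral_two_mul_cos_two_pi_div _)) hdvd)
      exact Nat.eq_of_mul_eq_mul_left (by positivity : 0 < 2 ^ α) <| Nat.dvd_antisymm
        (dvd_of_minpoly_two_mul_cos_eq (hpos e he) (hpos d hd) heq.symm)
        (dvd_of_minpoly_two_mul_cos_eq (hpos d hd) (hpos e he) heq)
    · obtain ⟨k, hk⟩ := Nat.dvd_of_mem_divisors hd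
      have hkodd : Odd k := (Nat.odd_mul.mp (hk ▸ hN)).2
      have := minpoly_two_mul_cos_dvd_C (hpos d hd) hkodd
      rwa [mul_assoc (2 ^ α) d k, ← hk] at this
  · rw [Chebyshev.natDegree_C_natCast, natDegree_prod_of_monic _ _ hmonic]
    refine Nat.le_of_mul_le_mul_left ?_ two_pos
    calc 2 * (2 ^ α * N) = ∑ d ∈ N.divisors, (4 * (2 ^ α * d)).totient := by
          conv_lhs => rw [← N.sum_totient]
          rw [Finset.mul_sum, Finset.mul_sum]
          refine Finset.sum_congr rfl fun d hd => ?_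
          have hcop : (2 ^ (α + 1 + 1)).Coprime d :=
            ((Nat.coprime_two_left.2 (hN.of_dvd_nat (Nat.dvd_of_mem_divisors hd))).pow_left _)
          rw [show 4 * (2 ^ α * d) = 2 ^ (α + 1 + 1) * d by ring, Nat.totient_mul hcop,
            Nat.totient_prime_pow_succ Nat.prime_two]
          ring
      _ ≤ 2 * ∑ d ∈ N.divisors,
          (minpoly ℚ (2 * Real.cos (2 * Real.pi / (4 * (2 ^ α * d) : ℕ)))).natDegree := by
        rw [Finset.mul_sum]
        exact Finset.sum_le_sum fun d hd =>
          totient_le_two_mul_natDegree_minpoly_two_mul_cos (Nat.mul_pos four_pos (hpos d hd))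

theorem chebyshevT_factorization (n : ℕ) (hn : 0 < n)
    (α N : ℕ) (hN : Odd N) (hnfact : n = 2 ^ α * N) (r : ℕ) (hr : r = 2 ^ (α + 2)) :
    Polynomial.Chebyshev.T ℚ (n : ℤ) =
      C (1 / 2 : ℚ) *
        ∏ d ∈ N.divisors,
          (minpoly ℚ (2 * Real.cos (2 * Real.pi / (r * d)))).comp (2 * X) := by
  have hcast : ∀ d : ℕ, (r : ℝ) * d = ((4 * (2 ^ α * d) : ℕ) : ℝ) := fun d => by
    rw [hr]; push_cast; ring
  simp only [hcast]
  rw [← Polynomial.prod_comp, ← chebyshevC_factorization α hN, ← hnfact,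
    Chebyshev.C_comp_two_mul_X, show (2 : ℚ[X]) = C 2 from rfl, ← mul_assoc, ← C_mul]
  norm_num
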